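/- arXiv:2308.16794 — 3 statements merged into one kernel-verified Lean document; each statement's English description precedes it below -/
import Mathlib

section
/- For μ ∈ ℝ let u_μ(θ) = 1 + μ·sin(2θ). Then lim_{μ→0} μ^{−2}·[ Q(u_μ) − S_{1,s}·(∫₀^{2π} |u_μ(θ)|^p dθ)^{2/p} ] = (4s/(3+2s))·π·α(2). (Since Q(u_μ − 1) = μ²·π·α(2), this expresses that the Bianchi–Egnell quotient along the family u_μ converges to the local constant c_BE^loc(s) = 4s/(3+2s) as μ → 0, showing sharpness of the local lower bound in dimension one.) -/
open MeasureTheory Real Filter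
open scoped ENNReal

/-- `α(ℓ) = Γ(ℓ + 1/2 + s) / Γ(ℓ + 1/2 - s)`. -/
noncomputable def alphaF (s : ℝ) (l : ℕ) : ℝ :=
  Real.Gamma ((l : ℝ) + 1/2 + s) / Real.Gamma ((l : ℝ) + 1/2 - s)

/-- Fourier coefficient `û(k) = (2π)⁻¹ ∫₀^{2π} u(θ) e^{-ikθ} dθ`. -/
noncomputable def fCoeff (u : ℝ → ℝ) (k : ℤ) : ℂ :=
  (2 * (Real.pi : ℂ))⁻¹ *
    ∫ θ in (0:ℝ)..(2 * Real.pi), (u θ : ℂ) * Complex.exp (-(Complex.I * k * θ))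

/-- The quadratic form `Q(u) = 2π ∑_{k ∈ ℤ} α(|k|) |û(k)|² ∈ [0,∞]`. -/
noncomputable def Qform (s : ℝ) (u : ℝ → ℝ) : ℝ≥0∞ :=
  ENNReal.ofReal (2 * Real.pi) *
    ∑' k : ℤ, ENNReal.ofReal (alphaF s k.natAbs * ‖fCoeff u k‖ ^ 2)


lemma int_exp (n : ℤ) : ∫ θ in (0:ℝ)..(2 * Real.pi), Complex.exp ((Complex.I * n) * θ)
    = if n = 0 then 2 * (Real.pi : ℂ) else 0 := by
  split_ifs with h
  · subst h; simp
  · rw [integral_exp_mul_complex (by simp [h])]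
    have : Complex.exp (Complex.I * n * ((2 * Real.pi : ℝ) : ℂ)) = 1 := by
      rw [Complex.exp_eq_one_iff]
      exact ⟨n, by push_cast; ring⟩
    rw [this]; simp

lemma fCoeff_u (μ : ℝ) (k : ℤ) : fCoeff (fun θ => 1 + μ * Real.sin (2 * θ)) k =
    (if k = 0 then 1 else 0) + (μ / 2 * Complex.I) * (if k = -2 then 1 else 0)
      - (μ / 2 * Complex.I) * (if k = 2 then 1 else 0) := by
  unfold fCoeff
  have h : ∀ θ : ℝ, ((1 + μ * Real.sin (2 * θ) : ℝ) : ℂ) * Complex.exp (-(Complex.I * k * θ))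
      = Complex.exp ((Complex.I * ((-k : ℤ) : ℂ)) * θ)
        + (μ / 2 * Complex.I) * Complex.exp ((Complex.I * ((-2 - k : ℤ) : ℂ)) * θ)
        - (μ / 2 * Complex.I) * Complex.exp ((Complex.I * ((2 - k : ℤ) : ℂ)) * θ) := by
    intro θ
    have h1 : Complex.exp ((Complex.I * ((-2 - k : ℤ) : ℂ)) * θ)
      = Complex.exp (-(2 * θ) * Complex.I) * Complex.exp (-(Complex.I * k * θ)) := by
      rw [← Complex.exp_add]; push_cast; ring_nf
    have h2 : Complex.exp ((Complex.I * ((2 - k : ℤ) : ℂ)) * θ)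
      = Complex.exp ((2 * θ) * Complex.I) * Complex.exp (-(Complex.I * k * θ)) := by
      rw [← Complex.exp_add]; push_cast; ring_nf
    have h3 : Complex.exp ((Complex.I * ((-k : ℤ) : ℂ)) * θ) = Complex.exp (-(Complex.I * k * θ)) := by
      push_cast; ring_nf
    rw [h1, h2, h3]
    push_cast
    rw [Complex.sin]
    ring
  have hc : ∀ n : ℤ, IntervalIntegrable (fun θ : ℝ => Complex.exp ((Complex.I * (n : ℂ)) * θ))
      volume 0 (2 * Real.pi) := fun n => Continuous.intervalIntegrable (by fun_prop) _ _
  simp_rw [h]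
  rw [intervalIntegral.integral_sub ((hc _).add ((hc _).const_mul _)) ((hc _).const_mul _),
    intervalIntegral.integral_add (hc _) ((hc _).const_mul _),
    intervalIntegral.integral_const_mul, intervalIntegral.integral_const_mul,
    int_exp, int_exp, int_exp]
  have hp : (Real.pi : ℂ) ≠ 0 := by exact_mod_cast Real.pi_ne_zero
  have e1 : (-k = 0) ↔ k = 0 := by omega
  have e2 : (-2 - k = 0) ↔ k = -2 := by omega
  have e3 : (2 - k = 0) ↔ k = 2 := by omega
  simp only [e1, e2, e3]
  split_ifs <;> field_simp <;> simp <;> ring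

lemma alphaF_pos (s : ℝ) (hs : s ∈ Set.Ioo (0:ℝ) (1/2)) (l : ℕ) : 0 < alphaF s l := by
  have h0 : (0:ℝ) ≤ l := Nat.cast_nonneg l
  unfold alphaF
  exact div_pos (Real.Gamma_pos_of_pos (by linarith [hs.1])) (Real.Gamma_pos_of_pos (by linarith [hs.2]))

lemma Q_u (s : ℝ) (hs : s ∈ Set.Ioo (0:ℝ) (1/2)) (μ : ℝ) :
    (Qform s (fun θ => 1 + μ * Real.sin (2 * θ))).toReal =
      2 * Real.pi * alphaF s 0 + μ ^ 2 * (Real.pi * alphaF s 2) := by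
  unfold Qform
  have a0 := alphaF_pos s hs 0
  have a2 := alphaF_pos s hs 2
  rw [tsum_eq_sum (s := {0, 2, -2})]
  · rw [← ENNReal.ofReal_sum_of_nonneg
      (fun i _ => mul_nonneg (alphaF_pos s hs _).le (by positivity)),
      ← ENNReal.ofReal_mul (by positivity), ENNReal.toReal_ofReal]
    · simp [fCoeff_u]
      ring_nf
      simp
    · exact mul_nonneg (by positivity) (Finset.sum_nonneg
        (fun i _ => mul_nonneg (alphaF_pos s hs _).le (by positivity)))
  · intro k hk
    simp only [Finset.mem_insert, Finset.mem_singleton, not_or] at hk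
    simp [fCoeff_u, hk]

lemma alpha_rel (s : ℝ) (hs : s ∈ Set.Ioo (0:ℝ) (1/2)) :
    alphaF s 0 = alphaF s 2 * ((3 - 2 * s) * (1 - 2 * s) / ((3 + 2 * s) * (1 + 2 * s))) := by
  obtain ⟨h0, h1⟩ := hs
  unfold alphaF
  have e1 : Real.Gamma (((2:ℕ):ℝ) + 1/2 + s) = (3/2 + s) * ((1/2 + s) * Real.Gamma (1/2 + s)) := by
    rw [← Real.Gamma_add_one (by linarith : 1/2 + s ≠ 0),
      show 1/2 + s + 1 = 3/2 + s by ring, ← Real.Gamma_add_one (by linarith : 3/2 + s ≠ 0)]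
    congr 1; push_cast; ring

  have e2 : Real.Gamma (((2:ℕ):ℝ) + 1/2 - s) = (3/2 - s) * ((1/2 - s) * Real.Gamma (1/2 - s)) := by
    rw [← Real.Gamma_add_one (by linarith : 1/2 - s ≠ 0),
      show 1/2 - s + 1 = 3/2 - s by ring, ← Real.Gamma_add_one (by linarith : 3/2 - s ≠ 0)]
    congr 1; push_cast; ring
  rw [e1, e2]
  have g : Real.Gamma (1/2 - s) ≠ 0 := (Real.Gamma_pos_of_pos (by linarith)).ne'
  have : 3/2 - s ≠ 0 := by linarith
  have : 1/2 - s ≠ 0 := by linarith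
  have : 3 + 2 * s ≠ 0 := by linarith
  have : 1 + 2 * s ≠ 0 := by linarith
  simp only [Nat.cast_zero, zero_add]
  generalize Real.Gamma (1/2 - s) = G at *
  generalize Real.Gamma (1/2 + s) = H at *
  rw [show 3/2 + s = (3 + 2 * s)/2 by ring, show 1/2 + s = (1 + 2 * s)/2 by ring,
    show 3/2 - s = (3 - 2 * s)/2 by ring, show 1/2 - s = (1 - 2 * s)/2 by ring]
  have : 3 - 2 * s ≠ 0 := by linarith
  have : 1 - 2 * s ≠ 0 := by linarith
  field_simp

lemma taylor2 (p : ℝ) (ε : ℝ) (hε : 0 < ε) : ∃ δ > 0, δ < 1 ∧ ∀ x : ℝ, |x| ≤ δ →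
    |(1 + x) ^ p - 1 - p * x - p * (p - 1) / 2 * x ^ 2| ≤ ε * x ^ 2 := by
  have hd : HasDerivAt (fun x : ℝ => p * (1 + x) ^ (p - 1)) (p * (p - 1)) 0 := by
    have h := ((hasDerivAt_id (0:ℝ)).const_add 1).rpow_const (p := p - 1) (Or.inl (by simp))
    have := h.const_mul p
    simpa using this
  have := (hasDerivAt_iff_isLittleO.1 hd).def hε
  obtain ⟨η, hη, hb⟩ := Metric.eventually_nhds_iff.1 this
  refine ⟨min (η / 2) (1 / 2), by positivity, by
    have := min_le_right (η/2) (1/2); linarith, ?_⟩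
  intro x hx
  have hx1 : |x| ≤ η / 2 := hx.trans (min_le_left _ _)
  have hx2 : |x| ≤ 1 / 2 := hx.trans (min_le_right _ _)
  have key := (convex_uIcc (0:ℝ) x).norm_image_sub_le_of_norm_hasDerivWithin_le
    (f := fun x => (1 + x) ^ p - 1 - p * x - p * (p - 1) / 2 * x ^ 2)
    (f' := fun x => p * (1 + x) ^ (p - 1) - p - p * (p - 1) * x) (C := ε * |x|) (x := 0) (y := x)
    ?_ ?_ Set.left_mem_uIcc Set.right_mem_uIcc
  · simp at key
    calc _ ≤ _ := key
      _ = _ := by rw [mul_assoc, ← sq, sq_abs]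
  · intro y hy
    have hy' : |y| ≤ |x| := by simpa using Set.abs_sub_left_of_mem_uIcc hy
    have hy1 := abs_le.1 (hy'.trans hx2)
    have h := ((hasDerivAt_id y).const_add 1).rpow_const (p := p) (Or.inl (by simp; linarith [hy1.1]))
    have h2 := ((h.sub_const 1).sub ((hasDerivAt_id y).const_mul p)).sub
      (((hasDerivAt_id y).pow 2).const_mul (p * (p - 1) / 2))
    refine HasDerivAt.hasDerivWithinAt ?_
    refine (h2.congr_deriv ?_)
    simp; ring
  · intro y hy
    have hy' : |y| ≤ |x| := by simpa using Set.abs_sub_left_of_mem_uIcc hy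
    have := hb (y := y) (by simp; linarith)
    simp at this
    rw [Real.norm_eq_abs]
    calc _ = |p * (1 + y) ^ (p - 1) - p - y * (p * (p - 1))| := by ring_nf
      _ ≤ _ := this
      _ ≤ _ := by gcongr

lemma int_sin : ∫ θ in (0:ℝ)..(2 * Real.pi), Real.sin (2 * θ) = 0 := by
  rw [intervalIntegral.integral_comp_mul_left (fun x => Real.sin x) (by norm_num)]
  simp
  rw [show 2 * (2 * Real.pi) = ((2:ℕ):ℝ) * (2 * Real.pi) by norm_num, Real.cos_nat_mul_two_pi]; simp

lemma int_sin_sq : ∫ θ in (0:ℝ)..(2 * Real.pi), Real.sin (2 * θ) ^ 2 = Real.pi := by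
  rw [intervalIntegral.integral_comp_mul_left (fun x => Real.sin x ^ 2) (by norm_num)]
  rw [integral_sin_sq]
  rw [show 2 * (2 * Real.pi) = ((4:ℕ):ℝ) * Real.pi by norm_num; ring, Real.sin_nat_mul_pi]
  simp; ring

lemma int_lim (p : ℝ) (hp : 0 ≤ p) : Tendsto (fun μ : ℝ => (μ ^ 2)⁻¹ *
    ((∫ θ in (0:ℝ)..(2 * Real.pi), |1 + μ * Real.sin (2 * θ)| ^ p) - 2 * Real.pi))
    (nhdsWithin 0 {(0:ℝ)}ᶜ) (nhds (p * (p - 1) / 2 * Real.pi)) := by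
  have hpi := Real.pi_pos
  rw [Metric.tendsto_nhdsWithin_nhds]
  intro ε hε
  obtain ⟨δ, hδ, hδ1, hT⟩ := taylor2 p (ε / (4 * Real.pi)) (by positivity)
  refine ⟨δ, hδ, ?_⟩
  intro μ hμ hμδ
  have hμ0 : μ ≠ 0 := hμ
  simp at hμδ
  have hc : Continuous (fun θ : ℝ => |1 + μ * Real.sin (2 * θ)| ^ p) :=
    Continuous.rpow_const (by fun_prop) (fun _ => Or.inr hp)
  have hbound := intervalIntegral.norm_integral_le_of_norm_le_const (a := 0) (b := 2 * Real.pi)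
    (f := fun θ : ℝ => |1 + μ * Real.sin (2 * θ)| ^ p - (1 + p * μ * Real.sin (2 * θ)
      + p * (p - 1) / 2 * μ ^ 2 * Real.sin (2 * θ) ^ 2)) (C := ε / (4 * Real.pi) * μ ^ 2) ?_
  · have i1 : ∀ f : ℝ → ℝ, Continuous f → IntervalIntegrable f volume 0 (2 * Real.pi) :=
      fun f hf => hf.intervalIntegrable _ _
    rw [intervalIntegral.integral_sub (i1 _ hc) (i1 _ (by fun_prop)),
      intervalIntegral.integral_add (i1 _ (by fun_prop)) (i1 _ (by fun_prop)),
      intervalIntegral.integral_add (i1 _ (by fun_prop)) (i1 _ (by fun_prop)),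
      intervalIntegral.integral_const_mul, intervalIntegral.integral_const_mul,
      int_sin, int_sin_sq] at hbound
    set J := ∫ θ in (0:ℝ)..(2 * Real.pi), |1 + μ * Real.sin (2 * θ)| ^ p
    simp only [Real.norm_eq_abs, intervalIntegral.integral_const, smul_eq_mul, sub_zero, mul_one, mul_zero, add_zero] at hbound
    rw [abs_of_pos (by positivity : 0 < 2 * Real.pi)] at hbound
    rw [Real.dist_eq]
    have : (μ ^ 2)⁻¹ * (J - 2 * Real.pi) - p * (p - 1) / 2 * Real.pi
      = (μ ^ 2)⁻¹ * (J - (2 * Real.pi + p * (p - 1) / 2 * μ ^ 2 * Real.pi)) := by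
      field_simp; ring
    rw [this, abs_mul, abs_of_pos (by positivity)]
    calc _ ≤ (μ ^ 2)⁻¹ * (ε / (4 * Real.pi) * μ ^ 2 * (2 * Real.pi)) := by gcongr
      _ = ε / 2 := by field_simp; norm_num
      _ < ε := by linarith
  · intro θ _
    have hs := Real.abs_sin_le_one (2 * θ)
    have hx : |μ * Real.sin (2 * θ)| ≤ |μ| := by
      rw [abs_mul]; exact mul_le_of_le_one_right (abs_nonneg _) hs
    have h1 := abs_le.1 (hx.trans hμδ.le)
    have := hT _ (hx.trans hμδ.le)
    rw [abs_of_pos (by linarith [h1.1] : 0 < 1 + μ * Real.sin (2 * θ)), Real.norm_eq_abs]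
    calc _ = _ := by congr 1; ring
      _ ≤ _ := this
      _ ≤ _ := by gcongr ?_ * ?_; exact sq_le_sq.2 hx

lemma pow_lim (p q : ℝ) (hp : 0 ≤ p) : Tendsto (fun μ : ℝ => (μ ^ 2)⁻¹ *
    ((∫ θ in (0:ℝ)..(2 * Real.pi), |1 + μ * Real.sin (2 * θ)| ^ p) ^ q - (2 * Real.pi) ^ q))
    (nhdsWithin 0 {(0:ℝ)}ᶜ)
    (nhds (q * (2 * Real.pi) ^ (q - 1) * (p * (p - 1) / 2 * Real.pi))) := by
  have hpi := Real.pi_pos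
  have hl := int_lim p hp
  set J : ℝ → ℝ := fun μ => ∫ θ in (0:ℝ)..(2 * Real.pi), |1 + μ * Real.sin (2 * θ)| ^ p with hJ
  have hJl : Tendsto J (nhdsWithin 0 {(0:ℝ)}ᶜ) (nhds (2 * Real.pi)) := by
    have h2 : Tendsto (fun μ : ℝ => μ ^ 2) (nhdsWithin 0 {(0:ℝ)}ᶜ) (nhds 0) := by
      have : Tendsto (fun μ : ℝ => μ ^ 2) (nhds 0) (nhds (0 ^ 2)) := (continuous_pow 2).tendsto 0
      simpa using this.mono_left nhdsWithin_le_nhds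
    have h3 := (h2.mul hl).add_const (2 * Real.pi)
    rw [zero_mul, zero_add] at h3
    refine h3.congr' ?_
    filter_upwards [self_mem_nhdsWithin] with μ hμ
    have : μ ≠ 0 := hμ
    simp only [hJ]
    field_simp
    ring
  have hd : HasDerivAt (fun y : ℝ => y ^ q) (q * (2 * Real.pi) ^ (q - 1)) (2 * Real.pi) :=
    Real.hasDerivAt_rpow_const (Or.inl (by positivity))
  have hcont := continuousAt_dslope_same.2 hd.differentiableAt
  have h4 := hcont.tendsto.comp hJl
  rw [dslope_same, hd.deriv] at h4
  refine (h4.mul hl).congr ?_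
  intro μ
  have := sub_smul_dslope (fun y : ℝ => y ^ q) (2 * Real.pi) (J μ)
  simp only [smul_eq_mul] at this
  simp only [Function.comp]
  change _ = (μ ^ 2)⁻¹ * (J μ ^ q - (2 * Real.pi) ^ q)
  rw [← this]
  ring

theorem deficit_along_sin_family (s : ℝ) (hs : s ∈ Set.Ioo (0:ℝ) (1/2)) :
    Tendsto (fun μ : ℝ =>
      (μ ^ 2)⁻¹ * ((Qform s (fun θ => 1 + μ * Real.sin (2 * θ))).toReal -
        (alphaF s 0 * (2 * Real.pi) ^ (2 * s)) *
          (∫ θ in (0:ℝ)..(2 * Real.pi), |1 + μ * Real.sin (2 * θ)| ^ (2 / (1 - 2*s)))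
            ^ ((2:ℝ) / (2 / (1 - 2*s)))))
      (nhdsWithin 0 {(0:ℝ)}ᶜ)
      (nhds ((4 * s / (3 + 2 * s)) * Real.pi * alphaF s 2)) := by
  have hpi := Real.pi_pos
  obtain ⟨h0, h1⟩ := id hs
  have hq : (2:ℝ) / (2 / (1 - 2*s)) = 1 - 2 * s := by
    have : 1 - 2 * s ≠ 0 := by linarith
    field_simp
  rw [hq]
  have h := pow_lim (2 / (1 - 2*s)) (1 - 2*s) (div_nonneg (by norm_num) (by linarith))
  have h2 := (h.const_mul (alphaF s 0 * (2 * Real.pi) ^ (2 * s))).const_sub (Real.pi * alphaF s 2)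
  have e : (2 * Real.pi) ^ (2 * s) * (2 * Real.pi) ^ (1 - 2 * s) = 2 * Real.pi := by
    rw [← Real.rpow_add (by positivity)]; simp
  have e' : (2 * Real.pi) ^ (2 * s) * (2 * Real.pi) ^ (1 - 2 * s - 1) = 1 := by
    rw [← Real.rpow_add (by positivity)]; ring_nf; simp
  have hlim : Real.pi * alphaF s 2 - alphaF s 0 * (2 * Real.pi) ^ (2 * s) *
      ((1 - 2*s) * (2 * Real.pi) ^ (1 - 2*s - 1) *
        ((2 / (1 - 2*s)) * ((2 / (1 - 2*s)) - 1) / 2 * Real.pi))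
      = (4 * s / (3 + 2 * s)) * Real.pi * alphaF s 2 := by
    have : Real.pi * alphaF s 2 - alphaF s 0 * (2 * Real.pi) ^ (2 * s) *
      ((1 - 2*s) * (2 * Real.pi) ^ (1 - 2*s - 1) *
        ((2 / (1 - 2*s)) * ((2 / (1 - 2*s)) - 1) / 2 * Real.pi)) =
        Real.pi * alphaF s 2 - alphaF s 0 * ((1 - 2*s) * 
        ((2 / (1 - 2*s)) * ((2 / (1 - 2*s)) - 1) / 2 * Real.pi)) *
        ((2 * Real.pi) ^ (2 * s) * (2 * Real.pi) ^ (1 - 2 * s - 1)) := by ring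
    rw [this, e', alpha_rel s hs]
    have : 1 - 2 * s ≠ 0 := by linarith
    have : 3 + 2 * s ≠ 0 := by linarith
    have : 1 + 2 * s ≠ 0 := by linarith
    field_simp
    ring
  rw [hlim] at h2
  refine h2.congr' ?_
  filter_upwards [self_mem_nhdsWithin] with μ hμ
  have hμ0 : μ ≠ 0 := hμ
  rw [Q_u s hs]
  set K := (∫ θ in (0:ℝ)..(2 * Real.pi), |1 + μ * Real.sin (2 * θ)| ^ (2 / (1 - 2*s))) ^ (1 - 2 * s)
  have : 2 * Real.pi * alphaF s 0
    = alphaF s 0 * ((2 * Real.pi) ^ (2 * s) * (2 * Real.pi) ^ (1 - 2 * s)) := by rw [e]; ring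
  rw [this]
  field_simp
  ring
end

section
/- Let d ≥ 1 be an integer and take the exponent p = 3, i.e. define v_β(ω) = (1−β²)^{d/6}·(1 − β·ω_{d+1})^{−d/3} for β ∈ (−1,1). Then for every β ∈ (0,1), writing γ(β) = 2β/(1+β²), one has ∫_{𝕊^d} (v_β + v_{−β})³ dσ = 2·|𝕊^d| + 6·∫_{𝕊^d} v_{γ(β)} dσ. -/
open MeasureTheory Real

/-- The Sobolev optimizer `v_β(ω) = (1-β²)^{d/(2p)} (1 - β ω_{d+1})^{-d/p}` on `𝕊^d`. -/
noncomputable def vb (d : ℕ) (p β : ℝ) (ω : EuclideanSpace ℝ (Fin (d+1))) : ℝ :=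
  (1 - β^2) ^ ((d:ℝ)/(2*p)) * (1 - β * ω (Fin.last d)) ^ (-(d:ℝ)/p)

open scoped ENNReal NNReal

theorem hemi_finite (d : ℕ) (v : EuclideanSpace ℝ (Fin (d+1))) (hv : ‖v‖ = 1) :
    μH[(d:ℝ)] (Metric.sphere (0 : EuclideanSpace ℝ (Fin (d+1))) 1 ∩ {x | inner ℝ v x ≤ 0}) < ⊤ := by
  have hfin : Module.finrank ℝ (Submodule.span ℝ {v})ᗮ = d := by
    have : Fact (Module.finrank ℝ (EuclideanSpace ℝ (Fin (d+1))) = d + 1) := ⟨by simp⟩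
    exact Submodule.finrank_orthogonal_span_singleton (by rintro rfl; simp at hv)
  let K : Set (Submodule.span ℝ {v})ᗮ := Metric.closedBall 0 2
  have hK : IsCompact K := isCompact_closedBall _ _
  have hKc : Convex ℝ K := convex_closedBall _ _
  let g : (Submodule.span ℝ {v})ᗮ → EuclideanSpace ℝ (Fin (d+1)) := fun w => stereoInvFunAux v w
  have hg : ContDiff ℝ 1 g :=
    ContDiff.comp (g := stereoInvFunAux v) (f := ⇑((Submodule.span ℝ {v})ᗮ.subtypeL))
      contDiff_stereoInvFunAux (ContinuousLinearMap.contDiff _)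
  obtain ⟨C, hC⟩ := hg.contDiffOn.exists_lipschitzOnWith one_ne_zero hKc hK
  have hmeas : μH[(d:ℝ)] K < ⊤ := by
    have := isAddHaarMeasure_hausdorffMeasure (E := (Submodule.span ℝ {v})ᗮ)
    rw [hfin] at this
    exact hK.measure_lt_top
  refine lt_of_le_of_lt (measure_mono ?_) (lt_of_le_of_lt
    (hC.hausdorffMeasure_image_le (d := (d:ℝ)) (by positivity)) 
    (ENNReal.mul_lt_top (ENNReal.rpow_lt_top_of_nonneg (by positivity) ENNReal.coe_ne_top) hmeas))
  rintro x ⟨hx, hx0⟩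
  have hx1 : ‖x‖ = 1 := by simpa using hx
  simp only [Set.mem_ofPred_eq] at hx0
  have hne : x ≠ v := by
    rintro rfl
    rw [real_inner_self_eq_norm_sq, hv] at hx0
    norm_num at hx0
  refine ⟨stereoToFun v x, ?_, ?_⟩
  · simp only [K, mem_closedBall_zero_iff, stereoToFun_apply, norm_smul]
    have h1 : ‖(2 / (1 - inner ℝ v x) : ℝ)‖ ≤ 2 := by
      rw [Real.norm_of_nonneg (by apply div_nonneg <;> linarith), div_le_iff₀ (by linarith)]
      linarith
    have h2 := Submodule.norm_orthogonalProjectionOnto_apply_le (Submodule.span ℝ {v})ᗮ x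
    rw [hx1] at h2
    have := mul_le_mul h1 h2 (norm_nonneg _) (by norm_num)
    simpa using this
  · have := stereo_left_inv hv (x := ⟨x, hx⟩) hne
    exact congrArg Subtype.val this

theorem sphere_finite (d : ℕ) :
    μH[(d:ℝ)] (Metric.sphere (0 : EuclideanSpace ℝ (Fin (d+1))) 1) < ⊤ := by
  let v : EuclideanSpace ℝ (Fin (d+1)) := EuclideanSpace.single (Fin.last d) 1
  have hv : ‖v‖ = 1 := by simp [v]
  refine lt_of_le_of_lt (measure_mono ?_) (measure_union_lt_top (hemi_finite d v hv) 
    (hemi_finite d (-v) (by simpa using hv)))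
  intro x hx
  rcases le_total (inner ℝ v x) 0 with h | h
  · exact Or.inl ⟨hx, h⟩
  · exact Or.inr ⟨hx, by simpa using h⟩

theorem density_aux {X : Type*} [MeasurableSpace X] (μ ν : Measure X) (l : X → ℝ≥0)
    (hl : Measurable l) (hpos : ∀ x, l x ≠ 0) (d : ℕ) 
    (h : ∀ A, MeasurableSet A → ∀ a b : ℝ≥0, a ≠ 0 → (∀ x ∈ A, a ≤ l x ∧ l x ≤ b) →
      (a:ℝ≥0∞)^d * μ A ≤ ν A ∧ ν A ≤ (b:ℝ≥0∞)^d * μ A) :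
    ν = μ.withDensity (fun x => (l x : ℝ≥0∞)^d) := by
  have key : ∀ A, MeasurableSet A → ∀ q : ℝ≥0, 1 < q → 
      ν A ≤ (q:ℝ≥0∞)^d * ∫⁻ x in A, (l x : ℝ≥0∞)^d ∂μ ∧ 
      ∫⁻ x in A, (l x : ℝ≥0∞)^d ∂μ ≤ (q:ℝ≥0∞)^d * ν A := by
    intro A hA q hq
    have hq0 : q ≠ 0 := by positivity
    let P : ℤ → Set X := fun k => A ∩ l ⁻¹' Set.Ico (q^k) (q^(k+1))
    have hP : ∀ k, MeasurableSet (P k) := fun k => hA.inter (hl measurableSet_Ico)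
    have hdis : Pairwise (Function.onFun Disjoint P) := by
      intro i j hij
      refine Disjoint.mono Set.inter_subset_right Set.inter_subset_right ?_
      refine Disjoint.preimage _ ?_
      exact (zpow_right_mono₀ hq.le).pairwise_disjoint_on_Ico_succ hij
    have hU : A = ⋃ k, P k := by
      ext x
      simp only [P, Set.mem_iUnion, Set.mem_inter_iff, Set.mem_preimage]
      constructor
      · intro hx
        obtain ⟨n, hn⟩ := NNReal.exists_mem_Ico_zpow (hpos x) hq
        exact ⟨n, hx, hn⟩
      · rintro ⟨_, hx, _⟩; exact hx
    have hh := fun k => h (P k) (hP k) (q^k) (q^(k+1)) (zpow_ne_zero _ hq0)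
      (fun x hx => ⟨hx.2.1, hx.2.2.le⟩)
    have hpw : ∀ k : ℤ, ((q^(k+1) : ℝ≥0) : ℝ≥0∞)^d = (q:ℝ≥0∞)^d * ((q^k : ℝ≥0):ℝ≥0∞)^d := by
      intro k
      rw [zpow_add_one₀ hq0, ENNReal.coe_mul, mul_pow, mul_comm]
    have e1 : ν A = ∑' k, ν (P k) := by
      conv_lhs => rw [hU]
      exact measure_iUnion hdis hP
    have e2 : ∫⁻ x in A, (l x : ℝ≥0∞)^d ∂μ = ∑' k, ∫⁻ x in P k, (l x : ℝ≥0∞)^d ∂μ := by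
      conv_lhs => rw [hU]
      exact lintegral_iUnion hP hdis _
    rw [e1, e2, ← ENNReal.tsum_mul_left, ← ENNReal.tsum_mul_left]
    constructor
    · refine ENNReal.tsum_le_tsum fun k => (hh k).2.trans ?_
      rw [hpw, mul_assoc]
      gcongr
      rw [← setLIntegral_const]
      refine setLIntegral_mono' (hP k) fun x hx => ?_
      have := hx.2.1
      gcongr
    · refine ENNReal.tsum_le_tsum fun k => ?_
      refine le_trans ?_ (mul_le_mul_right (hh k).1 _)
      rw [← mul_assoc, ← hpw, ← setLIntegral_const]
      refine setLIntegral_mono' (hP k) fun x hx => ?_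
      have := hx.2.2.le
      gcongr
  have lim : ∀ a b : ℝ≥0∞, (∀ q : ℝ≥0, 1 < q → a ≤ (q:ℝ≥0∞)^d * b) → a ≤ b := by
    intro a b hab
    have ht : Filter.Tendsto (fun q : ℝ≥0 => (q:ℝ≥0∞)^d * b) (nhdsWithin 1 (Set.Ioi 1))
        (nhds (((1:ℝ≥0):ℝ≥0∞)^d * b)) := by
      refine ENNReal.Tendsto.mul_const ?_ (by simp)
      refine Filter.Tendsto.mono_left ?_ nhdsWithin_le_nhds
      exact ((ENNReal.continuous_pow d).comp ENNReal.continuous_coe).tendsto 1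
    have := ge_of_tendsto ht (by filter_upwards [self_mem_nhdsWithin] with q hq using hab q hq)
    simpa using this
  ext A hA
  rw [withDensity_apply _ hA]
  exact le_antisymm (lim _ _ fun q hq => (key A hA q hq).1) (lim _ _ fun q hq => (key A hA q hq).2)

/-- The conformal boost of the sphere. -/
noncomputable def mob (d : ℕ) (β : ℝ) (ω : EuclideanSpace ℝ (Fin (d+1))) :
    EuclideanSpace ℝ (Fin (d+1)) :=
  (1 - β * ω (Fin.last d))⁻¹ • (√(1 - β^2) • ω +
    (ω (Fin.last d) - β - √(1 - β^2) * ω (Fin.last d)) • EuclideanSpace.single (Fin.last d) (1:ℝ))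

theorem mob_measurable (d : ℕ) (β : ℝ) : Measurable (mob d β) := by
  unfold mob
  fun_prop

theorem last_le (d : ℕ) (x : EuclideanSpace ℝ (Fin (d+1))) (hx : x ∈ Metric.sphere (0 : EuclideanSpace ℝ (Fin (d+1))) 1) :
    |x (Fin.last d)| ≤ 1 := by
  have h1 : ‖x‖ = 1 := by simpa using hx
  have := PiLp.norm_apply_le x (Fin.last d)
  rwa [h1, Real.norm_eq_abs] at this

theorem den_ge (d : ℕ) (β : ℝ) (x : EuclideanSpace ℝ (Fin (d+1)))
    (hx : x ∈ Metric.sphere (0 : EuclideanSpace ℝ (Fin (d+1))) 1) :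
    1 - |β| ≤ 1 - β * x (Fin.last d) := by
  have h1 := last_le d x hx
  have h2 : β * x (Fin.last d) ≤ |β| * 1 := (le_abs_self _).trans (by rw [abs_mul]; gcongr)
  linarith

theorem mob_last (d : ℕ) (β : ℝ) (x : EuclideanSpace ℝ (Fin (d+1))) :
    mob d β x (Fin.last d) = (x (Fin.last d) - β) / (1 - β * x (Fin.last d)) := by
  simp [mob]
  ring

theorem mob_inner (d : ℕ) (β : ℝ) (hβ : |β| < 1) (x y : EuclideanSpace ℝ (Fin (d+1)))
    (hx : x ∈ Metric.sphere (0 : EuclideanSpace ℝ (Fin (d+1))) 1)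
    (hy : y ∈ Metric.sphere (0 : EuclideanSpace ℝ (Fin (d+1))) 1) :
    inner ℝ (mob d β x) (mob d β y) = 1 - (1 - β^2) * (1 - inner ℝ x y) / 
      ((1 - β * x (Fin.last d)) * (1 - β * y (Fin.last d))) := by
  have h1 := den_ge d β x hx
  have h2 := den_ge d β y hy
  have h3 : 1 - β * x (Fin.last d) ≠ 0 := by linarith
  have h4 : 1 - β * y (Fin.last d) ≠ 0 := by linarith
  have hr : √(1 - β^2) ^ 2 = 1 - β^2 := Real.sq_sqrt (by
    have := (sq_lt_one_iff_abs_lt_one β).2 hβ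
    linarith)
  simp only [mob, inner_smul_left, inner_smul_right, inner_add_left, inner_add_right,
    EuclideanSpace.inner_single_left, EuclideanSpace.inner_single_right]
  simp
  field_simp
  generalize √(1 - β^2) = r at *
  generalize x (Fin.last d) = s at *
  generalize y (Fin.last d) = t at *
  generalize inner ℝ x y = u at *
  linear_combination (u - s * t) * hr

theorem mob_mem (d : ℕ) (β : ℝ) (hβ : |β| < 1) (x : EuclideanSpace ℝ (Fin (d+1)))
    (hx : x ∈ Metric.sphere (0 : EuclideanSpace ℝ (Fin (d+1))) 1) :
    mob d β x ∈ Metric.sphere (0 : EuclideanSpace ℝ (Fin (d+1))) 1 := by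
  have h := mob_inner d β hβ x x hx hx
  have h1 : ‖x‖ = 1 := by simpa using hx
  rw [real_inner_self_eq_norm_sq, real_inner_self_eq_norm_sq, h1] at h
  have : ‖mob d β x‖ = 1 := by
    rw [← sq_eq_sq₀ (norm_nonneg _) (by norm_num), h]; norm_num
  simpa using this

theorem mob_den (d : ℕ) (β : ℝ) (hβ : |β| < 1) (x : EuclideanSpace ℝ (Fin (d+1)))
    (hx : x ∈ Metric.sphere (0 : EuclideanSpace ℝ (Fin (d+1))) 1) :
    1 - (-β) * mob d β x (Fin.last d) = (1 - β^2) / (1 - β * x (Fin.last d)) := by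
  have h1 := den_ge d β x hx
  have h3 : 1 - β * x (Fin.last d) ≠ 0 := by linarith
  rw [mob_last]
  field_simp
  ring

theorem mob_inv (d : ℕ) (β : ℝ) (hβ : |β| < 1) (x : EuclideanSpace ℝ (Fin (d+1)))
    (hx : x ∈ Metric.sphere (0 : EuclideanSpace ℝ (Fin (d+1))) 1) :
    mob d (-β) (mob d β x) = x := by
  have h1 := den_ge d β x hx
  have h3 : 1 - β * x (Fin.last d) ≠ 0 := by linarith
  have hb : 1 - β^2 ≠ 0 := by
    have := (sq_lt_one_iff_abs_lt_one β).2 hβ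
    linarith
  have hr : √(1 - β^2) ^ 2 = 1 - β^2 := Real.sq_sqrt (by
    have := (sq_lt_one_iff_abs_lt_one β).2 hβ
    linarith)
  conv_lhs => rw [mob]
  rw [mob_den d β hβ x hx, mob_last, mob, neg_sq]
  ext i
  simp
  generalize √(1 - β^2) = r at *
  generalize x (Fin.last d) = s at *
  generalize x.ofLp i = t at *
  by_cases hi : i = Fin.last d <;> simp only [hi] <;> simp <;> field_simp
  · linear_combination (t - s) * hr
  · linear_combination t * hr

theorem mob_dist (d : ℕ) (β : ℝ) (hβ : |β| < 1) (x y : EuclideanSpace ℝ (Fin (d+1)))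
    (hx : x ∈ Metric.sphere (0 : EuclideanSpace ℝ (Fin (d+1))) 1)
    (hy : y ∈ Metric.sphere (0 : EuclideanSpace ℝ (Fin (d+1))) 1) :
    dist (mob d β x) (mob d β y) ^ 2 = (√(1 - β^2) / (1 - β * x (Fin.last d))) * 
      (√(1 - β^2) / (1 - β * y (Fin.last d))) * dist x y ^ 2 := by
  have n1 : ‖x‖ = 1 := by simpa using hx
  have n2 : ‖y‖ = 1 := by simpa using hy
  have n3 : ‖mob d β x‖ = 1 := by simpa using mob_mem d β hβ x hx
  have n4 : ‖mob d β y‖ = 1 := by simpa using mob_mem d β hβ y hy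
  have hr : √(1 - β^2) ^ 2 = 1 - β^2 := Real.sq_sqrt (by
    have := (sq_lt_one_iff_abs_lt_one β).2 hβ
    linarith)
  rw [dist_eq_norm, dist_eq_norm, norm_sub_sq_real, norm_sub_sq_real, n1, n2, n3, n4,
    mob_inner d β hβ x y hx hy, div_mul_div_comm, ← sq √(1 - β^2), hr]
  ring

/-- conformal factor -/
noncomputable def lam (d : ℕ) (β : ℝ) (ω : EuclideanSpace ℝ (Fin (d+1))) : ℝ≥0 :=
  (√(1 - β^2) / max (1 - β * ω (Fin.last d)) (1 - |β|)).toNNReal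

theorem lam_eq (d : ℕ) (β : ℝ) (hβ : |β| < 1) (x : EuclideanSpace ℝ (Fin (d+1)))
    (hx : x ∈ Metric.sphere (0 : EuclideanSpace ℝ (Fin (d+1))) 1) :
    (lam d β x : ℝ) = √(1 - β^2) / (1 - β * x (Fin.last d)) := by
  have h1 := den_ge d β x hx
  rw [lam, max_eq_left h1, Real.coe_toNNReal]
  exact div_nonneg (Real.sqrt_nonneg _) (by linarith)

theorem lam_ne (d : ℕ) (β : ℝ) (hβ : |β| < 1) (x : EuclideanSpace ℝ (Fin (d+1))) :
    lam d β x ≠ 0 := by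
  have : 0 < 1 - β^2 := by
    have := (sq_lt_one_iff_abs_lt_one β).2 hβ
    linarith
  have h2 : 0 < max (1 - β * x (Fin.last d)) (1 - |β|) := lt_max_of_lt_right (by linarith)
  rw [lam]
  exact (Real.toNNReal_pos.2 (by positivity)).ne'

theorem lam_meas (d : ℕ) (β : ℝ) : Measurable (lam d β) := by
  unfold lam
  fun_prop

theorem mob_map (d : ℕ) (β : ℝ) (hβ : |β| < 1) : 
    Measure.map (mob d (-β)) (μH[(d:ℝ)].restrict (Metric.sphere (0 : EuclideanSpace ℝ (Fin (d+1))) 1))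
     = (μH[(d:ℝ)].restrict (Metric.sphere (0 : EuclideanSpace ℝ (Fin (d+1))) 1)).withDensity
      (fun x => (lam d β x : ℝ≥0∞)^d) := by
  have hβ' : |-β| < 1 := by simpa using hβ
  refine density_aux _ _ _ (lam_meas d β) (lam_ne d β hβ) d ?_
  intro A hA a b ha hab
  have hm := mob_measurable d (-β) hA
  rw [Measure.map_apply (mob_measurable d _) hA, Measure.restrict_apply hA, 
    Measure.restrict_apply hm]
  set S := Metric.sphere (0 : EuclideanSpace ℝ (Fin (d+1))) 1 with hS
  have him : mob d (-β) ⁻¹' A ∩ S = mob d β '' (A ∩ S) := by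
    ext y
    constructor
    · rintro ⟨h1, h2⟩
      refine ⟨mob d (-β) y, ⟨h1, mob_mem d _ hβ' y h2⟩, ?_⟩
      simpa using mob_inv d (-β) hβ' y h2
    · rintro ⟨x, ⟨h1, h2⟩, rfl⟩
      refine ⟨?_, mob_mem d β hβ x h2⟩
      rw [Set.mem_preimage, mob_inv d β hβ x h2]; exact h1
  have him' : A ∩ S = mob d (-β) '' (mob d (-β) ⁻¹' A ∩ S) := by
    rw [him, Set.image_image]
    ext x
    constructor
    · intro h; exact ⟨x, h, mob_inv d β hβ x h.2⟩
    · rintro ⟨y, h, rfl⟩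
      simp only
      rw [mob_inv d β hβ y h.2]; exact h
  have hd : ∀ x ∈ A ∩ S, ∀ y ∈ A ∩ S, a * dist x y ≤ dist (mob d β x) (mob d β y) ∧ 
      dist (mob d β x) (mob d β y) ≤ b * dist x y := by
    intro x hx y hy
    have e := mob_dist d β hβ x y hx.2 hy.2
    rw [← lam_eq d β hβ x hx.2, ← lam_eq d β hβ y hy.2] at e
    have ax : (a:ℝ) ≤ lam d β x := (hab x hx.1).1
    have ay : (a:ℝ) ≤ lam d β y := (hab y hy.1).1
    have bx : (lam d β x : ℝ) ≤ b := (hab x hx.1).2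
    have hby : (lam d β y : ℝ) ≤ b := (hab y hy.1).2
    constructor
    · refine (sq_le_sq₀ (by positivity) dist_nonneg).1 ?_
      rw [e, mul_pow, sq (a:ℝ)]
      gcongr
    · refine (sq_le_sq₀ dist_nonneg (by positivity)).1 ?_
      rw [e, mul_pow, sq (b:ℝ)]
      gcongr
  constructor
  · have L : LipschitzOnWith a⁻¹ (mob d (-β)) (mob d (-β) ⁻¹' A ∩ S) := by
      refine LipschitzOnWith.of_dist_le_mul ?_
      rw [him]
      rintro _ ⟨x, hx, rfl⟩ _ ⟨y, hy, rfl⟩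
      rw [mob_inv d β hβ x hx.2, mob_inv d β hβ y hy.2]
      have ha' : (0:ℝ) < a := by positivity
      rw [NNReal.coe_inv, inv_mul_eq_div, le_div_iff₀ ha', mul_comm]
      exact (hd x hx y hy).1
    have := L.hausdorffMeasure_image_le (d := (d:ℝ)) (by positivity)
    rw [← him', ENNReal.rpow_natCast] at this
    calc _ ≤ (a:ℝ≥0∞)^d * (((a⁻¹:ℝ≥0):ℝ≥0∞)^d * μH[(d:ℝ)] (mob d (-β) ⁻¹' A ∩ S)) := by gcongr
      _ = _ := by
        rw [← mul_assoc, ← mul_pow, ← ENNReal.coe_mul, mul_inv_cancel₀ ha]; simp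
  · have L : LipschitzOnWith b (mob d β) (A ∩ S) := 
      LipschitzOnWith.of_dist_le_mul fun x hx y hy => (hd x hx y hy).2
    have := L.hausdorffMeasure_image_le (d := (d:ℝ)) (by positivity)
    rwa [← him, ENNReal.rpow_natCast] at this

theorem mob_integral (d : ℕ) (β : ℝ) (hβ : |β| < 1) (f : EuclideanSpace ℝ (Fin (d+1)) → ℝ)
    (hf : Measurable f) :
    ∫ x in Metric.sphere (0 : EuclideanSpace ℝ (Fin (d+1))) 1, (lam d β x : ℝ)^d * f x ∂μH[(d:ℝ)] =
    ∫ x in Metric.sphere (0 : EuclideanSpace ℝ (Fin (d+1))) 1, f (mob d (-β) x) ∂μH[(d:ℝ)] := by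
  rw [← integral_map (mob_measurable d _).aemeasurable hf.aestronglyMeasurable, mob_map d β hβ]
  have : (fun x => (lam d β x : ℝ≥0∞)^d) = fun x => ((lam d β x ^ d : ℝ≥0) : ℝ≥0∞) := by
    ext x; simp
  rw [this, integral_withDensity_eq_integral_smul ((lam_meas d β).pow_const d)]
  simp [NNReal.smul_def]

theorem vb_eq (d : ℕ) (β : ℝ) (hβ : |β| < 1) (x : EuclideanSpace ℝ (Fin (d+1)))
    (hx : x ∈ Metric.sphere (0 : EuclideanSpace ℝ (Fin (d+1))) 1) :
    vb d 3 β x = (√(1 - β^2) / (1 - β * x (Fin.last d))) ^ ((d:ℝ)/3) := by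
  have h1 := den_ge d β x hx
  have h2 : 0 ≤ 1 - β^2 := by
    have := (sq_lt_one_iff_abs_lt_one β).2 hβ
    linarith
  rw [vb, Real.div_rpow (Real.sqrt_nonneg _) (by linarith), Real.sqrt_eq_rpow, ← Real.rpow_mul h2,
    neg_div, Real.rpow_neg (by linarith), div_eq_mul_inv]
  congr 2
  ring

theorem vb_pos (d : ℕ) (β : ℝ) (hβ : |β| < 1) (x : EuclideanSpace ℝ (Fin (d+1)))
    (hx : x ∈ Metric.sphere (0 : EuclideanSpace ℝ (Fin (d+1))) 1) :
    0 < vb d 3 β x := by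
  have h1 := den_ge d β x hx
  have h2 : 0 < 1 - β^2 := by
    have := (sq_lt_one_iff_abs_lt_one β).2 hβ
    linarith
  rw [vb_eq d β hβ x hx]
  have h3 : 0 < 1 - β * x (Fin.last d) := by linarith
  positivity

theorem vb_cube (d : ℕ) (β : ℝ) (hβ : |β| < 1) (x : EuclideanSpace ℝ (Fin (d+1)))
    (hx : x ∈ Metric.sphere (0 : EuclideanSpace ℝ (Fin (d+1))) 1) :
    vb d 3 β x ^ 3 = (lam d β x : ℝ)^d := by
  rw [vb_eq d β hβ x hx, ← lam_eq d β hβ x hx, ← Real.rpow_mul_natCast (NNReal.coe_nonneg _),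
    ← Real.rpow_natCast]
  congr 1
  push_cast
  ring

theorem vb_meas (d : ℕ) (β : ℝ) : Measurable (vb d 3 β) := by
  unfold vb
  fun_prop

theorem vb_contOn (d : ℕ) (β : ℝ) (hβ : |β| < 1) :
    ContinuousOn (vb d 3 β) (Metric.sphere (0 : EuclideanSpace ℝ (Fin (d+1))) 1) := by
  unfold vb
  refine ContinuousOn.mul continuousOn_const (ContinuousOn.rpow_const ?_ ?_)
  · fun_prop
  · intro x hx
    have h1 := den_ge d β x hx
    left; linarith

theorem integrable_sphere (d : ℕ) (f : EuclideanSpace ℝ (Fin (d+1)) → ℝ)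
    (hf : ContinuousOn f (Metric.sphere (0 : EuclideanSpace ℝ (Fin (d+1))) 1)) :
    IntegrableOn f (Metric.sphere (0 : EuclideanSpace ℝ (Fin (d+1))) 1) μH[(d:ℝ)] := by
  have : IsFiniteMeasure (μH[(d:ℝ)].restrict (Metric.sphere (0 : EuclideanSpace ℝ (Fin (d+1))) 1)) :=
    ⟨by simpa using sphere_finite d⟩
  have h := hf.integrableOn_compact
    (μ := μH[(d:ℝ)].restrict (Metric.sphere (0 : EuclideanSpace ℝ (Fin (d+1))) 1))
    (isCompact_sphere _ _)
  rwa [IntegrableOn, Measure.restrict_restrict Metric.isClosed_sphere.measurableSet,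
    Set.inter_self] at h

theorem int_cube (d : ℕ) (β : ℝ) (hβ : |β| < 1) :
    ∫ x in Metric.sphere (0 : EuclideanSpace ℝ (Fin (d+1))) 1, vb d 3 β x ^ 3 ∂μH[(d:ℝ)] =
    (μH[(d:ℝ)] (Metric.sphere (0 : EuclideanSpace ℝ (Fin (d+1))) 1)).toReal := by
  have := mob_integral d β hβ (fun _ => 1) measurable_const
  rw [setIntegral_congr_fun Metric.isClosed_sphere.measurableSet
    (g := fun x => (lam d β x : ℝ)^d * 1) (fun x hx => by simpa using vb_cube d β hβ x hx), this]
  simp [Measure.real]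

theorem ratio (d : ℕ) (β : ℝ) (hβ : |β| < 1) (y : EuclideanSpace ℝ (Fin (d+1)))
    (hy : y ∈ Metric.sphere (0 : EuclideanSpace ℝ (Fin (d+1))) 1)
    (hγ : |-(2 * β / (1 + β^2))| < 1) :
    vb d 3 (-β) (mob d (-β) y) / vb d 3 β (mob d (-β) y) = vb d 3 (-(2 * β / (1 + β^2))) y := by
  have hβ' : |-β| < 1 := by simpa using hβ
  have hm := mob_mem d (-β) hβ' y hy
  have h1 := den_ge d β _ hm
  have h1' := den_ge d (-β) _ hm
  have h2 := den_ge d (-β) y hy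
  have h2' := den_ge d (-(2 * β / (1 + β^2))) y hy
  have hb : 0 < 1 - β^2 := by
    have := (sq_lt_one_iff_abs_lt_one β).2 hβ
    linarith
  have hs : √(1 - (-(2 * β / (1 + β^2)))^2) = (1 - β^2) / (1 + β^2) := by
    rw [Real.sqrt_eq_iff_mul_self_eq_of_pos (by positivity)]
    field_simp
    ring
  have hsq : 0 < √(1 - β^2) := Real.sqrt_pos.2 hb
  rw [vb_eq d _ hβ' _ hm, vb_eq d _ hβ _ hm, vb_eq d _ hγ _ hy, hs, neg_sq, ← Real.div_rpow]
  · congr 1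
    have q1 : 0 < 1 - -β * y (Fin.last d) := by linarith
    have q2 : 0 < 1 - β * mob d (-β) y (Fin.last d) := by linarith
    have q3 : 0 < 1 - -β * mob d (-β) y (Fin.last d) := by linarith
    have q4 : 0 < 1 - -(2 * β / (1 + β^2)) * y (Fin.last d) := by linarith
    rw [div_div_div_cancel_left' _ _ hsq.ne', div_div, div_eq_div_iff q3.ne' (by positivity)]
    have q5 : 1 + β * y (Fin.last d) ≠ 0 := by linarith
    rw [mob_last, neg_mul, sub_neg_eq_add, sub_neg_eq_add]
    field_simp
    ring
  · exact div_nonneg hsq.le (by linarith)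
  · exact div_nonneg hsq.le (by linarith)

theorem int_mixed (d : ℕ) (β : ℝ) (hβ : |β| < 1) (hγ : |-(2 * β / (1 + β^2))| < 1) :
    ∫ x in Metric.sphere (0 : EuclideanSpace ℝ (Fin (d+1))) 1,
      vb d 3 β x ^ 2 * vb d 3 (-β) x ∂μH[(d:ℝ)] =
    ∫ x in Metric.sphere (0 : EuclideanSpace ℝ (Fin (d+1))) 1,
      vb d 3 (-(2 * β / (1 + β^2))) x ∂μH[(d:ℝ)] := by
  have := mob_integral d β hβ (fun x => vb d 3 (-β) x / vb d 3 β x)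
    ((vb_meas d _).div (vb_meas d _))
  have hS := (Metric.isClosed_sphere (x := (0 : EuclideanSpace ℝ (Fin (d+1)))) (ε := 1)).measurableSet
  rw [setIntegral_congr_fun hS (g := fun x => (lam d β x : ℝ)^d * (vb d 3 (-β) x / vb d 3 β x)),
    this]
  · exact setIntegral_congr_fun hS fun y hy => ratio d β hβ y hy hγ
  · intro x hx
    simp only
    rw [← vb_cube d β hβ x hx]
    have := vb_pos d β hβ x hx
    field_simp

theorem int_neg (d : ℕ) (β : ℝ) :
    ∫ x in Metric.sphere (0 : EuclideanSpace ℝ (Fin (d+1))) 1, vb d 3 (-β) x ∂μH[(d:ℝ)] =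
    ∫ x in Metric.sphere (0 : EuclideanSpace ℝ (Fin (d+1))) 1, vb d 3 β x ∂μH[(d:ℝ)] := by
  have hmp :=
    (IsometryEquiv.neg (EuclideanSpace ℝ (Fin (d+1)))).measurePreserving_hausdorffMeasure (d:ℝ)
  have := hmp.setIntegral_preimage_emb
    (IsometryEquiv.neg (EuclideanSpace ℝ (Fin (d+1)))).toHomeomorph.measurableEmbedding
    (vb d 3 β) (Metric.sphere (0 : EuclideanSpace ℝ (Fin (d+1))) 1)
  rw [← this]
  have hp : (IsometryEquiv.neg (EuclideanSpace ℝ (Fin (d+1)))) ⁻¹' Metric.sphere 0 1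
      = Metric.sphere 0 1 := by
    ext x; simp
  rw [hp]
  congr 1
  ext x
  simp [vb]

/-- For `p = 3`: `∫_{𝕊^d} (v_β + v_{-β})³ dσ = 2|𝕊^d| + 6 ∫_{𝕊^d} v_{γ(β)} dσ`
with `γ(β) = 2β/(1+β²)`. -/
theorem cube_of_two_bubbles (d : ℕ) (hd : 1 ≤ d) (β : ℝ) (hβ : β ∈ Set.Ioo (0:ℝ) 1) :
    (∫ ω in Metric.sphere (0 : EuclideanSpace ℝ (Fin (d+1))) 1,
        (vb d 3 β ω + vb d 3 (-β) ω)^3 ∂μH[(d:ℝ)])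
      = 2 * (μH[(d:ℝ)] (Metric.sphere (0 : EuclideanSpace ℝ (Fin (d+1))) 1)).toReal +
        6 * ∫ ω in Metric.sphere (0 : EuclideanSpace ℝ (Fin (d+1))) 1,
              vb d 3 (2 * β / (1 + β^2)) ω ∂μH[(d:ℝ)] := by
  have h0 := hβ.1
  have h1 := hβ.2
  have hb : |β| < 1 := abs_lt.2 ⟨by linarith, h1⟩
  have hb' : |-β| < 1 := by simpa using hb
  have hγ : |2 * β / (1 + β^2)| < 1 := by
    rw [abs_of_pos (by positivity), div_lt_one (by positivity)]
    nlinarith [sq_pos_of_pos (sub_pos.2 h1)]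
  have hγ' : |-(2 * β / (1 + β^2))| < 1 := by simpa using hγ
  have c1 := vb_contOn d β hb
  have c2 := vb_contOn d (-β) hb'
  have i1 : IntegrableOn (fun ω => vb d 3 β ω ^ 3) (Metric.sphere (0 : EuclideanSpace ℝ (Fin (d+1))) 1) μH[(d:ℝ)] :=
    integrable_sphere d _ (c1.pow 3)
  have i2 : IntegrableOn (fun ω => vb d 3 (-β) ω ^ 3) (Metric.sphere (0 : EuclideanSpace ℝ (Fin (d+1))) 1) μH[(d:ℝ)] :=
    integrable_sphere d _ (c2.pow 3)
  have i3 : IntegrableOn (fun ω => 3 * (vb d 3 β ω ^ 2 * vb d 3 (-β) ω)) (Metric.sphere (0 : EuclideanSpace ℝ (Fin (d+1))) 1) μH[(d:ℝ)] :=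
    (integrable_sphere d _ ((c1.pow 2).mul c2)).const_mul 3
  have i4 : IntegrableOn (fun ω => 3 * (vb d 3 (-β) ω ^ 2 * vb d 3 β ω)) (Metric.sphere (0 : EuclideanSpace ℝ (Fin (d+1))) 1) μH[(d:ℝ)] :=
    (integrable_sphere d _ ((c2.pow 2).mul c1)).const_mul 3
  have i12 : IntegrableOn (fun ω => vb d 3 β ω ^ 3 + vb d 3 (-β) ω ^ 3) (Metric.sphere (0 : EuclideanSpace ℝ (Fin (d+1))) 1) μH[(d:ℝ)] :=
    i1.add i2
  have i123 : IntegrableOn (fun ω => vb d 3 β ω ^ 3 + vb d 3 (-β) ω ^ 3 + 3 * (vb d 3 β ω ^ 2 * vb d 3 (-β) ω)) (Metric.sphere (0 : EuclideanSpace ℝ (Fin (d+1))) 1) μH[(d:ℝ)] :=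
    i12.add i3
  have m1 := int_mixed d β hb hγ'
  have m2 := int_mixed d (-β) hb' (by simpa [neg_div] using hγ)
  simp only [neg_neg, neg_sq, mul_neg, neg_div] at m2
  have e : ∀ ω, (vb d 3 β ω + vb d 3 (-β) ω)^3 = ((vb d 3 β ω ^ 3 + vb d 3 (-β) ω ^ 3) +
      3 * (vb d 3 β ω ^ 2 * vb d 3 (-β) ω)) + 3 * (vb d 3 (-β) ω ^ 2 * vb d 3 β ω) := by
    intro ω; ring
  simp_rw [e]
  rw [integral_add i123 i4, integral_add i12 i3, integral_add i1 i2,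
    integral_const_mul, integral_const_mul, m1, m2, int_neg, int_cube d β hb, int_cube d _ hb']
  ring
end

section
/- Let d ≥ 1 be an integer and take the exponent p = 4, i.e. define v_β(ω) = (1−β²)^{d/8}·(1 − β·ω_{d+1})^{−d/4} for β ∈ (−1,1). Then for every β ∈ (0,1), writing γ(β) = 2β/(1+β²), one has ∫_{𝕊^d} v_β² · v_{−β}² dσ = ∫_{𝕊^d} v_{γ(β)}² dσ. -/
open MeasureTheory Real

section Helpers
open Set

/-- General one-sided conformal change of variables for the Hausdorff measure. -/
lemma hausdorff_conformal_le {X : Type*} [MetricSpace X] [MeasurableSpace X] [BorelSpace X]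
    (d : ℕ) (S : Set X) (hS : MeasurableSet S) (T T' : X → X) (lam : X → ℝ)
    (hT : Measurable T) (hlam : Measurable lam)
    (hpos : ∀ x ∈ S, 0 < lam x)
    (hmaps : ∀ x ∈ S, T' x ∈ S) (hinv : ∀ x ∈ S, T (T' x) = x)
    (hdist : ∀ x ∈ S, ∀ y ∈ S, dist (T x) (T y) ^ 2 = lam x * lam y * dist x y ^ 2)
    (f : X → ENNReal) (hf : Measurable f) :
    ∫⁻ x in S, f x ∂μH[(d:ℝ)] ≤ ∫⁻ x in S, ENNReal.ofReal (lam x) ^ d * f (T x) ∂μH[(d:ℝ)] := by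
  set w : X → ENNReal := fun x => ENNReal.ofReal (lam x) ^ d with hw
  have hwm : Measurable w := by fun_prop
  have key : ∀ r : ℝ, 1 < r → ∀ A ⊆ S, MeasurableSet A →
      μH[(d:ℝ)] (T '' A) ≤ ENNReal.ofReal r ^ d * ∫⁻ x in A, w x ∂μH[(d:ℝ)] := by
    intro r hr A hAS hA
    have hr0 : 0 < r := by linarith
    let P : ℤ → Set X := fun k => A ∩ lam ⁻¹' (Ico (r ^ k) (r ^ (Order.succ k)))
    have hPm : ∀ k, MeasurableSet (P k) := fun k => hA.inter (hlam measurableSet_Ico)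
    have hPd : Pairwise (Function.onFun Disjoint P) := by
      intro i j hij
      have hmono : Monotone (fun k : ℤ => r ^ k) := zpow_right_mono₀ hr.le
      have := hmono.pairwise_disjoint_on_Ico_succ hij
      exact ((Disjoint.preimage lam this).inter_left' A).inter_right' A
    have hPU : A = ⋃ k, P k := by
      ext x
      simp only [P, mem_iUnion, mem_inter_iff, mem_preimage]
      constructor
      · intro hx
        obtain ⟨k, hk⟩ := exists_mem_Ico_zpow (hpos x (hAS hx)) hr
        exact ⟨k, hx, hk⟩
      · rintro ⟨k, hx, -⟩
        exact hx
    have hpiece : ∀ k, μH[(d:ℝ)] (T '' P k) ≤ ENNReal.ofReal r ^ d * ∫⁻ x in P k, w x ∂μH[(d:ℝ)] := by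
      intro k
      have hK : 0 < r ^ (k+1) := zpow_pos hr0 _
      have hLip : LipschitzOnWith (r ^ (k+1)).toNNReal T (P k) := by
        apply LipschitzOnWith.of_dist_le_mul
        intro x hx y hy
        rw [Real.coe_toNNReal _ hK.le]
        refine (sq_le_sq₀ dist_nonneg (by positivity)).1 ?_
        rw [hdist x (hAS hx.1) y (hAS hy.1), mul_pow]
        have h1 := hx.2.2.le
        have h2 := hy.2.2.le
        simp only [Order.succ_eq_add_one] at h1 h2
        have := mul_le_mul h1 h2 (hpos y (hAS hy.1)).le hK.le
        rw [sq (r ^ (k+1))]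
        gcongr
      have h1 := hLip.hausdorffMeasure_image_le (d := (d:ℝ)) (Nat.cast_nonneg d)
      refine h1.trans ?_
      have h2 : ENNReal.ofReal (r ^ k) ^ d * μH[(d:ℝ)] (P k) ≤ ∫⁻ x in P k, w x ∂μH[(d:ℝ)] := by
        rw [← setLIntegral_const]
        apply setLIntegral_mono' (hPm k)
        intro x hx
        simp only [hw]
        gcongr
        exact hx.2.1
      calc _ = ENNReal.ofReal r ^ d * (ENNReal.ofReal (r ^ k) ^ d * μH[(d:ℝ)] (P k)) := by
            rw [← mul_assoc, ← mul_pow, ← ENNReal.ofReal_mul hr0.le, ENNReal.rpow_natCast,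
              zpow_add_one₀ hr0.ne', mul_comm r]
            rfl
        _ ≤ _ := by gcongr
    calc μH[(d:ℝ)] (T '' A) = μH[(d:ℝ)] (⋃ k, T '' P k) := by rw [← image_iUnion, ← hPU]
      _ ≤ ∑' k, μH[(d:ℝ)] (T '' P k) := measure_iUnion_le _
      _ ≤ ∑' k, ENNReal.ofReal r ^ d * ∫⁻ x in P k, w x ∂μH[(d:ℝ)] := ENNReal.tsum_le_tsum hpiece
      _ = ENNReal.ofReal r ^ d * ∫⁻ x in A, w x ∂μH[(d:ℝ)] := by
        rw [ENNReal.tsum_mul_left, ← lintegral_iUnion hPm hPd, ← hPU]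
  have key2 : ∀ A ⊆ S, MeasurableSet A → μH[(d:ℝ)] (T '' A) ≤ ∫⁻ x in A, w x ∂μH[(d:ℝ)] := by
    intro A hAS hA
    have hlim : Filter.Tendsto (fun r : ℝ => ENNReal.ofReal r ^ d * ∫⁻ x in A, w x ∂μH[(d:ℝ)])
        (nhdsWithin 1 (Ioi 1)) (nhds (1 * ∫⁻ x in A, w x ∂μH[(d:ℝ)])) := by
      apply ENNReal.Tendsto.mul_const _ (Or.inl one_ne_zero)
      have : Continuous (fun r : ℝ => ENNReal.ofReal r ^ d) :=
        (ENNReal.continuous_pow d).comp ENNReal.continuous_ofReal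
      have h := this.tendsto 1
      simp only [ENNReal.ofReal_one, one_pow] at h
      exact h.mono_left nhdsWithin_le_nhds
    rw [one_mul] at hlim
    apply ge_of_tendsto hlim
    filter_upwards [self_mem_nhdsWithin] with r hr
    exact key r hr A hAS hA
  have hle : (μH[(d:ℝ)] : Measure X).restrict S ≤ (((μH[(d:ℝ)] : Measure X).restrict S).withDensity w).map T := by
    rw [Measure.le_iff]
    intro B hB
    rw [Measure.map_apply hT hB, withDensity_apply _ (hT hB), Measure.restrict_apply hB,
      Measure.restrict_restrict (hT hB)]
    refine le_trans (measure_mono ?_) (key2 (T ⁻¹' B ∩ S) inter_subset_right ((hT hB).inter hS))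
    rintro x ⟨hxB, hxS⟩
    refine ⟨T' x, ⟨?_, hmaps x hxS⟩, hinv x hxS⟩
    simpa [hinv x hxS] using hxB
  calc _ ≤ ∫⁻ x, f x ∂((((μH[(d:ℝ)] : Measure X).restrict S).withDensity w).map T) :=
        lintegral_mono' hle le_rfl
    _ = _ := by
      rw [lintegral_map hf hT]
      rw [show (fun a => f (T a)) = f ∘ T from rfl, lintegral_withDensity_eq_lintegral_mul _ hwm (hf.comp hT)]
      rfl

/-- The conformal boost of the sphere with parameter `b`. -/
noncomputable def boost (d : ℕ) (b : ℝ) (ω : EuclideanSpace ℝ (Fin (d+1))) :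
    EuclideanSpace ℝ (Fin (d+1)) :=
  WithLp.toLp 2 (fun i => if i = Fin.last d then (ω (Fin.last d) + b) / (1 + b * ω (Fin.last d))
    else √(1 - b^2) * ω i / (1 + b * ω (Fin.last d)))

lemma boost_last (d : ℕ) (b : ℝ) (ω : EuclideanSpace ℝ (Fin (d+1))) :
    boost d b ω (Fin.last d) = (ω (Fin.last d) + b) / (1 + b * ω (Fin.last d)) := by
  simp [boost]

lemma boost_castSucc (d : ℕ) (b : ℝ) (ω : EuclideanSpace ℝ (Fin (d+1))) (i : Fin d) :
    boost d b ω i.castSucc = √(1 - b^2) * ω i.castSucc / (1 + b * ω (Fin.last d)) := by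
  simp [boost, (Fin.castSucc_lt_last i).ne]

lemma sphere_iff (d : ℕ) (ω : EuclideanSpace ℝ (Fin (d+1))) :
    ω ∈ Metric.sphere (0 : EuclideanSpace ℝ (Fin (d+1))) 1 ↔
      ∑ i : Fin d, ω i.castSucc ^ 2 + ω (Fin.last d) ^ 2 = 1 := by
  rw [mem_sphere_zero_iff_norm, ← sq_eq_sq₀ (norm_nonneg _) zero_le_one,
    EuclideanSpace.real_norm_sq_eq, Fin.sum_univ_castSucc, one_pow]

lemma sphere_last (d : ℕ) (ω : EuclideanSpace ℝ (Fin (d+1)))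
    (h : ω ∈ Metric.sphere (0 : EuclideanSpace ℝ (Fin (d+1))) 1) :
    -1 ≤ ω (Fin.last d) ∧ ω (Fin.last d) ≤ 1 := by
  rw [sphere_iff] at h
  have : 0 ≤ ∑ i : Fin d, ω i.castSucc ^ 2 := Finset.sum_nonneg (fun i _ => sq_nonneg _)
  constructor <;> nlinarith

lemma den_pos {b t : ℝ} (hb : -1 < b ∧ b < 1) (ht : -1 ≤ t ∧ t ≤ 1) : 0 < 1 + b * t := by
  have := abs_lt.2 hb
  have h2 := abs_le.2 ht
  have : |b * t| < 1 := by
    rw [abs_mul]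
    nlinarith [abs_nonneg b, abs_nonneg t]
  linarith [(abs_lt.1 this).1]

lemma boost_mem (d : ℕ) {b : ℝ} (hb : -1 < b ∧ b < 1) (ω : EuclideanSpace ℝ (Fin (d+1)))
    (h : ω ∈ Metric.sphere (0 : EuclideanSpace ℝ (Fin (d+1))) 1) :
    boost d b ω ∈ Metric.sphere (0 : EuclideanSpace ℝ (Fin (d+1))) 1 := by
  have hd := den_pos hb (sphere_last d ω h)
  rw [sphere_iff] at h ⊢
  have hs : √(1 - b^2) ^ 2 = 1 - b^2 := Real.sq_sqrt (by nlinarith)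
  simp only [boost_last, boost_castSucc, div_pow, mul_pow, hs]
  rw [← Finset.sum_div, ← Finset.mul_sum, eq_sub_of_add_eq h]
  field_simp
  ring

lemma boost_inv (d : ℕ) {b : ℝ} (hb : -1 < b ∧ b < 1) (ω : EuclideanSpace ℝ (Fin (d+1)))
    (h : ω ∈ Metric.sphere (0 : EuclideanSpace ℝ (Fin (d+1))) 1) :
    boost d b (boost d (-b) ω) = ω := by
  have hb' : -1 < -b ∧ -b < 1 := ⟨by linarith, by linarith⟩
  have hd := den_pos hb' (sphere_last d ω h)
  have hpos : 0 < 1 - b^2 := by nlinarith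
  have hd0 : 1 + -(b * ω (Fin.last d)) ≠ 0 := by
    rw [← neg_mul]
    exact hd.ne'
  have hd1 : 1 - b * ω (Fin.last d) ≠ 0 := by rwa [sub_eq_add_neg]
  have hs : √(1 - b^2) ^ 2 = 1 - b^2 := Real.sq_sqrt hpos.le
  have hden : 1 + b * ((ω (Fin.last d) + -b) / (1 + -b * ω (Fin.last d)))
      = (1 - b^2) / (1 + -b * ω (Fin.last d)) := by
    field_simp
    ring
  ext i
  refine Fin.lastCases ?_ (fun i => ?_) i
  · rw [boost_last, boost_last, hden]
    rw [div_add' _ _ _ hd.ne', div_div_div_cancel_right₀ hd.ne', div_eq_iff hpos.ne']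
    ring
  · rw [boost_castSucc, boost_castSucc, boost_last, hden, neg_sq]
    field_simp
    rw [hs]

lemma boost_dist (d : ℕ) {b : ℝ} (hb : -1 < b ∧ b < 1) (x y : EuclideanSpace ℝ (Fin (d+1)))
    (hx : x ∈ Metric.sphere (0 : EuclideanSpace ℝ (Fin (d+1))) 1)
    (hy : y ∈ Metric.sphere (0 : EuclideanSpace ℝ (Fin (d+1))) 1) :
    dist (boost d b x) (boost d b y) ^ 2 =
      (√(1 - b^2) / (1 + b * x (Fin.last d))) * (√(1 - b^2) / (1 + b * y (Fin.last d)))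
        * dist x y ^ 2 := by
  have hdx := den_pos hb (sphere_last d x hx)
  have hdy := den_pos hb (sphere_last d y hy)
  have gen : ∀ u v : EuclideanSpace ℝ (Fin (d+1)),
      u ∈ Metric.sphere (0 : EuclideanSpace ℝ (Fin (d+1))) 1 →
      v ∈ Metric.sphere (0 : EuclideanSpace ℝ (Fin (d+1))) 1 →
      dist u v ^ 2 = 2 - 2 * (∑ i : Fin d, u i.castSucc * v i.castSucc
        + u (Fin.last d) * v (Fin.last d)) := by
    intro u v hu hv
    rw [sphere_iff] at hu hv
    rw [dist_eq_norm, EuclideanSpace.real_norm_sq_eq, Fin.sum_univ_castSucc]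
    simp only [PiLp.sub_apply, sub_sq, Finset.sum_add_distrib, Finset.sum_sub_distrib, mul_assoc,
      ← Finset.mul_sum]
    linarith
  rw [gen _ _ (boost_mem d hb x hx) (boost_mem d hb y hy), gen x y hx hy]
  have hs : √(1 - b^2) ^ 2 = 1 - b^2 := Real.sq_sqrt (by nlinarith)
  have hsum : ∑ i : Fin d, boost d b x i.castSucc * boost d b y i.castSucc =
      (1 - b^2) / ((1 + b * x (Fin.last d)) * (1 + b * y (Fin.last d))) *
        ∑ i : Fin d, x i.castSucc * y i.castSucc := by
    rw [Finset.mul_sum]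
    refine Finset.sum_congr rfl fun i _ => ?_
    rw [boost_castSucc, boost_castSucc]
    field_simp
    rw [hs]
  have hprod : (√(1 - b^2) / (1 + b * x (Fin.last d))) * (√(1 - b^2) / (1 + b * y (Fin.last d)))
      = (1 - b^2) / ((1 + b * x (Fin.last d)) * (1 + b * y (Fin.last d))) := by
    rw [div_mul_div_comm, ← sq, hs]
  rw [hsum, hprod, boost_last, boost_last]
  generalize ∑ i : Fin d, x i.castSucc * y i.castSucc = q
  field_simp
  ring

lemma boost_measurable (d : ℕ) (b : ℝ) : Measurable (boost d b) := by
  unfold boost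
  refine (WithLp.measurable_toLp 2 _).comp ?_
  refine measurable_pi_lambda _ fun i => ?_
  split_ifs <;> fun_prop

lemma boost_lintegral_le (d : ℕ) {b : ℝ} (hb : -1 < b ∧ b < 1)
    (f : EuclideanSpace ℝ (Fin (d+1)) → ENNReal) (hf : Measurable f) :
    ∫⁻ x in Metric.sphere (0 : EuclideanSpace ℝ (Fin (d+1))) 1, f x ∂μH[(d:ℝ)] ≤
    ∫⁻ x in Metric.sphere (0 : EuclideanSpace ℝ (Fin (d+1))) 1,
      ENNReal.ofReal (√(1 - b^2) / (1 + b * x (Fin.last d))) ^ d * f (boost d b x)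
      ∂μH[(d:ℝ)] := by
  have hb' : -1 < -b ∧ -b < 1 := ⟨by linarith, by linarith⟩
  apply hausdorff_conformal_le d _ Metric.isClosed_sphere.measurableSet (boost d b) (boost d (-b))
    (fun x => √(1 - b^2) / (1 + b * x (Fin.last d))) (boost_measurable d b) (by fun_prop)
    _ (boost_mem d hb') (boost_inv d hb) (fun x hx y hy => boost_dist d hb x y hx hy) f hf
  intro x hx
  have := den_pos hb (sphere_last d x hx)
  have h1 : 0 < 1 - b^2 := by nlinarith
  positivity

lemma sqrt_pow_eq {z : ℝ} (hz : 0 ≤ z) (d : ℕ) : √z ^ d = z ^ ((d:ℝ)/2) := by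
  rw [Real.sqrt_eq_rpow, ← Real.rpow_natCast, ← Real.rpow_mul hz]
  congr 1
  ring

lemma lhs_eq (d : ℕ) {β : ℝ} (hβ : β ∈ Ioo (0:ℝ) 1) (x : EuclideanSpace ℝ (Fin (d+1)))
    (h : x ∈ Metric.sphere (0 : EuclideanSpace ℝ (Fin (d+1))) 1) :
    vb d 4 β x ^ 2 * vb d 4 (-β) x ^ 2
      = √((1 - β^2) / ((1 + β * x (Fin.last d)) * (1 - β * x (Fin.last d)))) ^ d := by
  obtain ⟨h0, h1⟩ := hβ
  have hp := den_pos (b := β) ⟨by linarith, h1⟩ (sphere_last d x h)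
  have hm := den_pos (b := -β) ⟨by linarith, by linarith⟩ (sphere_last d x h)
  have hm' : 0 < 1 - β * x (Fin.last d) := by linarith
  have hs : 0 < 1 - β^2 := by nlinarith
  have e1 : ∀ z : ℝ, 0 < z → (z ^ (-(d:ℝ)/4)) ^ 2 = (z ^ ((d:ℝ)/2))⁻¹ := by
    intro z hz
    rw [← Real.rpow_natCast, ← Real.rpow_mul hz.le, ← Real.rpow_neg hz.le]
    congr 1
    push_cast
    ring
  have e2 : ((1 - β^2) ^ ((d:ℝ)/(2*4))) ^ 2 * ((1 - β^2) ^ ((d:ℝ)/(2*4))) ^ 2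
      = (1 - β^2) ^ ((d:ℝ)/2) := by
    rw [← pow_add, ← Real.rpow_natCast, ← Real.rpow_mul hs.le]
    congr 1
    push_cast
    ring
  rw [sqrt_pow_eq (by positivity), Real.div_rpow hs.le (by positivity),
    Real.mul_rpow hp.le hm'.le, ← e2]
  simp only [vb, mul_pow, neg_sq]
  rw [e1 _ hm', show 1 - -β * x (Fin.last d) = 1 + β * x (Fin.last d) by ring, e1 _ hp]
  field_simp

lemma rhs_eq (d : ℕ) {β : ℝ} (hβ : β ∈ Ioo (0:ℝ) 1) (x : EuclideanSpace ℝ (Fin (d+1)))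
    (h : x ∈ Metric.sphere (0 : EuclideanSpace ℝ (Fin (d+1))) 1) :
    vb d 4 (2 * β / (1 + β^2)) x ^ 2
      = √((1 - β^2) / (1 + β^2 - 2 * β * x (Fin.last d))) ^ d := by
  obtain ⟨h0, h1⟩ := hβ
  have ht := sphere_last d x h
  have hs : 0 < 1 - β^2 := by nlinarith
  have hq : 0 < 1 + β^2 - 2 * β * x (Fin.last d) := by nlinarith
  have ha : 0 < 1 + β^2 := by positivity
  have e3 : 1 - (2 * β / (1 + β^2))^2 = ((1 - β^2) / (1 + β^2))^2 := by
    field_simp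
    ring
  have e4 : 1 - 2 * β / (1 + β^2) * x (Fin.last d)
      = (1 + β^2 - 2 * β * x (Fin.last d)) / (1 + β^2) := by
    field_simp
  have e1 : ∀ z : ℝ, 0 < z → (z ^ (-(d:ℝ)/4)) ^ 2 = (z ^ ((d:ℝ)/2))⁻¹ := by
    intro z hz
    rw [← Real.rpow_natCast, ← Real.rpow_mul hz.le, ← Real.rpow_neg hz.le]
    congr 1
    push_cast
    ring
  have e2 : ∀ z : ℝ, 0 < z → ((z^2) ^ ((d:ℝ)/(2*4))) ^ 2 = z ^ ((d:ℝ)/2) := by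
    intro z hz
    rw [← Real.rpow_natCast, ← Real.rpow_natCast, ← Real.rpow_mul hz.le, ← Real.rpow_mul hz.le]
    congr 1
    push_cast
    ring
  rw [vb, mul_pow, e3, e4, e1 _ (by positivity), e2 _ (by positivity),
    sqrt_pow_eq (by positivity), Real.div_rpow hs.le ha.le, Real.div_rpow hq.le ha.le,
    Real.div_rpow hs.le hq.le]
  have := Real.rpow_pos_of_pos ha ((d:ℝ)/2)
  have := Real.rpow_pos_of_pos hq ((d:ℝ)/2)
  field_simp

end Helpers

/-- For `p = 4`: `∫_{𝕊^d} v_β² v_{-β}² dσ = ∫_{𝕊^d} v_{γ(β)}² dσ` with `γ(β) = 2β/(1+β²)`. -/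
theorem square_interaction_identity (d : ℕ) (hd : 1 ≤ d) (β : ℝ)
    (hβ : β ∈ Set.Ioo (0:ℝ) 1) :
    (∫ ω in Metric.sphere (0 : EuclideanSpace ℝ (Fin (d+1))) 1,
        vb d 4 β ω ^ 2 * vb d 4 (-β) ω ^ 2 ∂μH[(d:ℝ)])
      = ∫ ω in Metric.sphere (0 : EuclideanSpace ℝ (Fin (d+1))) 1,
          vb d 4 (2 * β / (1 + β^2)) ω ^ 2 ∂μH[(d:ℝ)] := by
  have hSm : MeasurableSet (Metric.sphere (0 : EuclideanSpace ℝ (Fin (d+1))) 1) :=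
    Metric.isClosed_sphere.measurableSet
  rw [setIntegral_congr_fun hSm (fun x hx => lhs_eq d hβ x hx),
    setIntegral_congr_fun hSm (fun x hx => rhs_eq d hβ x hx)]
  obtain ⟨h0, h1⟩ := hβ
  have hb : -1 < β ∧ β < 1 := ⟨by linarith, h1⟩
  have hb' : -1 < -β ∧ -β < 1 := ⟨by linarith, by linarith⟩
  have hs : 0 < 1 - β^2 := by nlinarith
  rw [integral_eq_lintegral_of_nonneg_ae (Filter.Eventually.of_forall fun x => by positivity)
      (Measurable.aestronglyMeasurable (by fun_prop)),
    integral_eq_lintegral_of_nonneg_ae (Filter.Eventually.of_forall fun x => by positivity)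
      (Measurable.aestronglyMeasurable (by fun_prop))]
  congr 1
  apply le_antisymm
  · refine (boost_lintegral_le d hb' _ (by fun_prop)).trans (le_of_eq ?_)
    refine setLIntegral_congr_fun hSm fun x hx => ?_
    have ht := sphere_last d x hx
    have hm := den_pos hb' ht
    have hd0 : 1 + -(β * x (Fin.last d)) ≠ 0 := by
      rw [← neg_mul]
      exact hm.ne'
    have hd1 : 1 - β * x (Fin.last d) ≠ 0 := by rwa [sub_eq_add_neg]
    have hq : 0 < 1 + β^2 - 2 * β * x (Fin.last d) := by nlinarith
    simp only [boost_last, neg_sq]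
    rw [← ENNReal.ofReal_pow (by positivity), ← ENNReal.ofReal_mul (by positivity), ← mul_pow]
    congr 2
    have e1 : 1 + β * ((x (Fin.last d) + -β) / (1 + -β * x (Fin.last d)))
        = (1 - β^2) / (1 + -β * x (Fin.last d)) := by
      field_simp
      ring
    have e2 : 1 - β * ((x (Fin.last d) + -β) / (1 + -β * x (Fin.last d)))
        = (1 + β^2 - 2 * β * x (Fin.last d)) / (1 + -β * x (Fin.last d)) := by
      field_simp
      ring
    rw [e1, e2]
    nth_rewrite 1 [← Real.sqrt_sq hm.le]
    rw [← Real.sqrt_div hs.le, ← Real.sqrt_mul (by positivity)]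
    congr 1
    field_simp
  · refine (boost_lintegral_le d hb _ (by fun_prop)).trans (le_of_eq ?_)
    refine setLIntegral_congr_fun hSm fun x hx => ?_
    have ht := sphere_last d x hx
    have hp := den_pos hb ht
    have hm := den_pos hb' ht
    have hm' : 0 < 1 - β * x (Fin.last d) := by linarith
    simp only [boost_last]
    rw [← ENNReal.ofReal_pow (by positivity), ← ENNReal.ofReal_mul (by positivity), ← mul_pow]
    congr 2
    have e1 : 1 + β^2 - 2 * β * ((x (Fin.last d) + β) / (1 + β * x (Fin.last d)))
        = (1 - β^2) * (1 - β * x (Fin.last d)) / (1 + β * x (Fin.last d)) := by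
      field_simp
      ring
    rw [e1]
    nth_rewrite 1 [← Real.sqrt_sq hp.le]
    rw [← Real.sqrt_div hs.le, ← Real.sqrt_mul (by positivity)]
    congr 1
    field_simp
end
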